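/- Let F be a 2-cocycle of a finite-dimensional Hopf algebra H, F_n the associated higher twists, and u = f⁽¹⁾S(f⁽²⁾) its Drinfeld element. Then for every n ≥ 1: Δⁿ(u) = F_n⁻¹ · u^{⊗n} · (S^{⊗n}(F_n⁻¹))^rev, where (−)^rev reverses the order of tensor factors. -/

import Mathlib

/-!
STATEMENT 9 (Lemma `lem:trick-3`(v), eq. (f-Du-u-Sd)):
For a 2-cocycle F of a finite-dimensional Hopf algebra H with Drinfeld element
u = f⁽¹⁾S(f⁽²⁾), for every n ≥ 1:
  Δⁿ(u) = F_n⁻¹ · u^{⊗n} · (S^{⊗n}(F_n⁻¹))^rev,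
where (−)^rev reverses the order of the tensor factors.
(Here `comulIter (n-1) = Δⁿ`, `Fseq F (n-1) = F_n`, and `F_n⁻¹ = Ring.inverse (F_n)`.)
-/

open TensorProduct

structure AlgBundle (k : Type) [CommRing k] where
  carrier : Type
  ring : Ring carrier
  alg : @Algebra k carrier _ ring.toSemiring

section
variable (k H : Type) [Field k] [Ring H] [HopfAlgebra k H]

noncomputable def tpowB : ℕ → AlgBundle k
  | 0 => ⟨H, inferInstance, inferInstance⟩
  | n + 1 =>
      letI := (tpowB n).ring
      letI := (tpowB n).alg
      ⟨TensorProduct k H (tpowB n).carrier, inferInstance, inferInstance⟩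

/-- `Tpow k H n` is the (n+1)-fold tensor power `H ⊗ (H ⊗ (⋯ ⊗ H))`. -/
noncomputable def Tpow (n : ℕ) : Type := (tpowB k H n).carrier

noncomputable instance instTpowRing (n : ℕ) : Ring (Tpow k H n) := (tpowB k H n).ring
noncomputable instance instTpowAlgebra (n : ℕ) : Algebra k (Tpow k H n) := (tpowB k H n).alg

/-- The iterated comultiplication `Δ^{n+1} : H → H^{⊗(n+1)}`. -/
noncomputable def comulIter : ∀ n : ℕ, H →ₗ[k] Tpow k H n
  | 0 => LinearMap.id
  | n + 1 =>
      show H →ₗ[k] TensorProduct k H (Tpow k H n) from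
        (TensorProduct.map LinearMap.id (comulIter n)) ∘ₗ Coalgebra.comul

/-- The higher twists of `F`:  `Fseq F n = F_{n+1}`. -/
noncomputable def Fseq (F : H ⊗[k] H) : ∀ n : ℕ, Tpow k H n
  | 0 => 1
  | n + 1 =>
      show TensorProduct k H (Tpow k H n) from
        ((1 : H) ⊗ₜ[k] Fseq F n) * (TensorProduct.map LinearMap.id (comulIter k H n) F)

/-- Cast between tensor powers of equal length. -/
noncomputable def tcast {a b : ℕ} (h : a = b) : Tpow k H a ≃ₗ[k] Tpow k H b :=
  h ▸ LinearEquiv.refl k (Tpow k H a)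

/-- The canonical identification `H^{⊗(a+1)} ⊗ H^{⊗(b+1)} ≅ H^{⊗(a+b+2)}`. -/
noncomputable def concEquiv : ∀ a b : ℕ, (Tpow k H a ⊗[k] Tpow k H b) ≃ₗ[k] Tpow k H (a + 1 + b)
  | 0, b =>
      (show (Tpow k H 0 ⊗[k] Tpow k H b) ≃ₗ[k] Tpow k H (b + 1) from
        LinearEquiv.refl k (Tpow k H 0 ⊗[k] Tpow k H b)).trans (tcast k H (by omega))
  | a + 1, b =>
      (show (Tpow k H (a+1) ⊗[k] Tpow k H b) ≃ₗ[k] H ⊗[k] (Tpow k H a ⊗[k] Tpow k H b) from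
        TensorProduct.assoc k H (Tpow k H a) (Tpow k H b)).trans
      ((TensorProduct.congr (LinearEquiv.refl k H) (concEquiv a b)).trans
        ((show (TensorProduct k H (Tpow k H (a + 1 + b))) ≃ₗ[k] Tpow k H (a + 1 + b + 1) from
            LinearEquiv.refl k _).trans (tcast k H (by omega))))


/-- The nested pure tensor `f 0 ⊗ f 1 ⊗ ⋯ ⊗ f n` of a tuple. -/
noncomputable def nest : ∀ n : ℕ, (Fin (n + 1) → H) → Tpow k H n
  | 0, f => f 0
  | n + 1, f =>
      show TensorProduct k H (Tpow k H n) from f 0 ⊗ₜ[k] nest n (fun i => f i.succ)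

/-- The canonical identification `H^{⊗(n+1)} ⊗ H ≅ H^{⊗(n+2)}`. -/
noncomputable def snocEquiv : ∀ n : ℕ, (Tpow k H n ⊗[k] H) ≃ₗ[k] Tpow k H (n + 1)
  | 0 => LinearEquiv.refl k (TensorProduct k H H)
  | n + 1 =>
      show (TensorProduct k H (Tpow k H n)) ⊗[k] H ≃ₗ[k] TensorProduct k H (Tpow k H (n+1)) from
        (TensorProduct.assoc k H (Tpow k H n) H).trans
          (TensorProduct.congr (LinearEquiv.refl k H) (snocEquiv n))

/-- `S ⊗ S ⊗ ⋯ ⊗ S` on `H^{⊗(n+1)}`. -/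
noncomputable def tmapPow (S : H →ₗ[k] H) : ∀ n : ℕ, Tpow k H n →ₗ[k] Tpow k H n
  | 0 => S
  | n + 1 =>
      show TensorProduct k H (Tpow k H n) →ₗ[k] TensorProduct k H (Tpow k H n) from
        TensorProduct.map S (tmapPow S n)

/-- Reversal of the tensor factors of `H^{⊗(n+1)}`. -/
noncomputable def revT : ∀ n : ℕ, Tpow k H n →ₗ[k] Tpow k H n
  | 0 => LinearMap.id
  | n + 1 =>
      show TensorProduct k H (Tpow k H n) →ₗ[k] TensorProduct k H (Tpow k H n) from
        (snocEquiv k H n).toLinearMap ∘ₗ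
          (TensorProduct.comm k H (Tpow k H n)).toLinearMap ∘ₗ
          (TensorProduct.map LinearMap.id (revT n))

end

namespace TwistAux

section two
variable {k H : Type} [Field k] [Ring H] [HopfAlgebra k H]

open Coalgebra Bialgebra

/-- a shortcut instance: the search for the ring structure on four legs is otherwise too deep -/
noncomputable instance instRing4 : Ring (H ⊗[k] (H ⊗[k] (H ⊗[k] H))) :=
  Algebra.TensorProduct.instRing (R := k) (A := H) (B := H ⊗[k] (H ⊗[k] H))

/-- comultiply the first leg -/
noncomputable def D1 (k H M : Type) [Field k] [Ring H] [HopfAlgebra k H] [Ring M] [Algebra k M] :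
    H ⊗[k] M →ₐ[k] H ⊗[k] (H ⊗[k] M) :=
  (Algebra.TensorProduct.assoc k k k H H M).toAlgHom.comp
    (Algebra.TensorProduct.map (comulAlgHom k H) (AlgHom.id k M))

/-- comultiply the second leg -/
noncomputable def D2 (k H M : Type) [Field k] [Ring H] [HopfAlgebra k H] [Ring M] [Algebra k M] :
    H ⊗[k] (H ⊗[k] M) →ₐ[k] H ⊗[k] (H ⊗[k] (H ⊗[k] M)) :=
  Algebra.TensorProduct.map (AlgHom.id k H) (D1 k H M)

/-- comultiply the last of two legs -/
noncomputable def DR (k H : Type) [Field k] [Ring H] [HopfAlgebra k H] :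
    H ⊗[k] H →ₐ[k] H ⊗[k] (H ⊗[k] H) :=
  Algebra.TensorProduct.map (AlgHom.id k H) (comulAlgHom k H)

/-- counit on the second leg -/
noncomputable def E2 (k H M : Type) [Field k] [Ring H] [HopfAlgebra k H] [Ring M] [Algebra k M] :
    H ⊗[k] (H ⊗[k] M) →ₐ[k] H ⊗[k] M :=
  Algebra.TensorProduct.map (AlgHom.id k H)
    ((Algebra.TensorProduct.lid k M).toAlgHom.comp
      (Algebra.TensorProduct.map (counitAlgHom k H) (AlgHom.id k M)))

/-- put two legs in the first two places -/
noncomputable def i12 (k H M : Type) [Field k] [Ring H] [HopfAlgebra k H] [Ring M] [Algebra k M] :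
    H ⊗[k] H →ₐ[k] H ⊗[k] (H ⊗[k] M) :=
  Algebra.TensorProduct.map (AlgHom.id k H) Algebra.TensorProduct.includeLeft

/-- put three legs in the first three places -/
noncomputable def j3 (k H : Type) [Field k] [Ring H] [HopfAlgebra k H] :
    H ⊗[k] (H ⊗[k] H) →ₐ[k] H ⊗[k] (H ⊗[k] (H ⊗[k] H)) :=
  Algebra.TensorProduct.map (AlgHom.id k H) (i12 k H H)

variable {M : Type} [Ring M] [Algebra k M]

lemma D1_tmul (a : H) (m : M) : D1 k H M (a ⊗ₜ m) =
    TensorProduct.assoc k H H M (comul (R := k) a ⊗ₜ m) := rfl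
lemma DR_tmul (a b : H) : DR k H (a ⊗ₜ b) = a ⊗ₜ comul (R := k) b := rfl
lemma D2_tmul (a : H) (x : H ⊗[k] M) : D2 k H M (a ⊗ₜ x) = a ⊗ₜ D1 k H M x := rfl
lemma i12_tmul (a b : H) : i12 k H M (a ⊗ₜ b) = a ⊗ₜ (b ⊗ₜ 1) := rfl
lemma j3_tmul (a : H) (x : H ⊗[k] H) : j3 k H (a ⊗ₜ x) = a ⊗ₜ i12 k H H x := rfl
lemma E2_tmul (a b : H) (m : M) : E2 k H M (a ⊗ₜ (b ⊗ₜ m)) =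
    a ⊗ₜ (counit (R := k) b • m) := rfl

lemma D1_D1 (x : H ⊗[k] M) : D1 k H (H ⊗[k] M) (D1 k H M x) = D2 k H M (D1 k H M x) := by
  induction x with
  | zero => simp
  | add x y hx hy => simp only [map_add, hx, hy]
  | tmul a m =>
    have h := Coalgebra.coassoc_apply (R := k) a
    have h1 : ∀ z : H ⊗[k] H, D1 k H (H ⊗[k] M) (TensorProduct.assoc k H H M (z ⊗ₜ m)) =
        TensorProduct.map LinearMap.id (TensorProduct.assoc k H H M).toLinearMap
        (TensorProduct.assoc k H (H ⊗[k] H) M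
          ((TensorProduct.assoc k H H H ((comul (R := k)).rTensor H z)) ⊗ₜ m)) := by
      intro z
      induction z with
      | zero => simp
      | add x y hx hy => simp only [map_add, hx, hy, TensorProduct.add_tmul]
      | tmul p q =>
        simp only [TensorProduct.assoc_tmul, D1_tmul, LinearMap.rTensor_tmul]
        generalize comul (R := k) p = w
        induction w with
        | zero => simp
        | add x y hx hy => simp only [map_add, hx, hy, TensorProduct.add_tmul]
        | tmul p q => simp
    have h2 : ∀ z : H ⊗[k] H, D2 k H M (TensorProduct.assoc k H H M (z ⊗ₜ m)) =
        TensorProduct.map LinearMap.id (TensorProduct.assoc k H H M).toLinearMap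
        (TensorProduct.assoc k H (H ⊗[k] H) M
          (((comul (R := k)).lTensor H z) ⊗ₜ m)) := by
      intro z
      induction z with
      | zero => simp
      | add x y hx hy => simp only [map_add, hx, hy, TensorProduct.add_tmul]
      | tmul p q => simp [D2_tmul, D1_tmul]
    rw [D1_tmul, h1, h2, h]

lemma D1_comul (h : H) : D1 k H H (comul (R := k) h) = DR k H (comul (R := k) h) :=
  Coalgebra.coassoc_apply (R := k) h

lemma D1_i12 (x : H ⊗[k] H) : D1 k H (H ⊗[k] H) (i12 k H H x) = j3 k H (D1 k H H x) := by
  induction x with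
  | zero => simp
  | add x y hx hy => simp only [map_add, hx, hy]
  | tmul a b =>
    simp only [i12_tmul, D1_tmul]
    generalize comul (R := k) a = w
    induction w with
    | zero => simp
    | add x y hx hy => simp only [map_add, hx, hy, TensorProduct.add_tmul]
    | tmul p q => simp [j3_tmul, i12_tmul]

lemma j3_i12 (x : H ⊗[k] H) : j3 k H (i12 k H H x) = i12 k H (H ⊗[k] H) x := by
  induction x with
  | zero => simp
  | add x y hx hy => simp only [map_add, hx, hy]
  | tmul a b => rfl

lemma j3_DR (x : H ⊗[k] H) : j3 k H (DR k H x) = D2 k H H (i12 k H H x) := by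
  induction x with
  | zero => simp
  | add x y hx hy => simp only [map_add, hx, hy]
  | tmul a b =>
    simp only [i12_tmul, D2_tmul, D1_tmul, DR_tmul, j3_tmul]
    congr 1
    generalize comul (R := k) b = w
    induction w with
    | zero => simp
    | add x y hx hy => simp only [map_add, hx, hy, TensorProduct.add_tmul]
    | tmul p q => simp [i12_tmul]

lemma D1_one_tmul (m : M) : D1 k H M (1 ⊗ₜ m) = 1 ⊗ₜ (1 ⊗ₜ m) := by
  rw [D1_tmul, Bialgebra.comul_one]; rfl

/-- the four-fold twist -/
lemma four (F : H ⊗[k] H)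
    (hF : ((1 : H) ⊗ₜ[k] F) * DR k H F = i12 k H H F * D1 k H H F) :
    i12 k H (H ⊗[k] H) F * ((1 : H) ⊗ₜ ((1 : H) ⊗ₜ F)) * D1 k H (H ⊗[k] H) (DR k H F) =
      ((1 : H) ⊗ₜ[k] i12 k H H F) * D2 k H H (((1 : H) ⊗ₜ[k] F) * DR k H F) := by
  have e1 : i12 k H (H ⊗[k] H) F * ((1 : H) ⊗ₜ ((1 : H) ⊗ₜ F)) * D1 k H (H ⊗[k] H) (DR k H F)
      = i12 k H (H ⊗[k] H) F * D1 k H (H ⊗[k] H) (i12 k H H F * D1 k H H F) := by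
    rw [← hF, map_mul, D1_one_tmul, mul_assoc]
  rw [e1, map_mul, ← mul_assoc, D1_i12, ← j3_i12, ← map_mul, ← hF, map_mul, j3_DR, D1_D1, hF,
    map_mul, ← mul_assoc]
  rfl

lemma E2_DR (x : H ⊗[k] H) : E2 k H H (DR k H x) = x := by
  induction x with
  | zero => simp
  | add x y hx hy => simp only [map_add, hx, hy]
  | tmul a b =>
    have h := Coalgebra.rTensor_counit_comul (R := k) b
    rw [DR_tmul]
    have : ∀ z : H ⊗[k] H, E2 k H H (a ⊗ₜ z) =
      a ⊗ₜ (TensorProduct.lid k H ((counit (R := k)).rTensor H z)) := fun z => rfl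
    rw [this, h]; simp

/-- the reversed antipode on two legs -/
noncomputable def R2 (k H : Type) [Field k] [Ring H] [HopfAlgebra k H] :
    H ⊗[k] H →ₗ[k] H ⊗[k] H :=
  (TensorProduct.comm k H H).toLinearMap ∘ₗ
    TensorProduct.map (HopfAlgebra.antipode k) (HopfAlgebra.antipode k)

lemma R2_tmul (a b : H) : R2 k H (a ⊗ₜ b) =
   (HopfAlgebra.antipode k b) ⊗ₜ (HopfAlgebra.antipode k a) := rfl

/-- `x1 ⊗ x2 ⊗ x3 ⊗ x4 ↦ x1 S(x4) ⊗ x2 S(x3)` -/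
noncomputable def Phi (k H : Type) [Field k] [Ring H] [HopfAlgebra k H] :
    H ⊗[k] (H ⊗[k] (H ⊗[k] H)) →ₗ[k] H ⊗[k] H :=
  LinearMap.mul' k (H ⊗[k] H) ∘ₗ TensorProduct.map LinearMap.id (R2 k H) ∘ₗ
    (TensorProduct.assoc k H H (H ⊗[k] H)).symm.toLinearMap

/-- `x1 ⊗ x2 ⊗ x3 ⊗ x4 ↦ S(x2) x3 ⊗ S(x1) x4` -/
noncomputable def Psi (k H : Type) [Field k] [Ring H] [HopfAlgebra k H] :
    H ⊗[k] (H ⊗[k] (H ⊗[k] H)) →ₗ[k] H ⊗[k] H :=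
  LinearMap.mul' k (H ⊗[k] H) ∘ₗ TensorProduct.map (R2 k H) LinearMap.id ∘ₗ
    (TensorProduct.assoc k H H (H ⊗[k] H)).symm.toLinearMap

/-- `a ⊗ b ↦ a S(b)` -/
noncomputable def N (k H : Type) [Field k] [Ring H] [HopfAlgebra k H] : H ⊗[k] H →ₗ[k] H :=
  LinearMap.mul' k H ∘ₗ TensorProduct.map LinearMap.id (HopfAlgebra.antipode k)

lemma N_tmul (a b : H) : N k H (a ⊗ₜ b) = a * HopfAlgebra.antipode k b := by simp [N]

lemma N_mul_comul (Z : H ⊗[k] H) (h : H) :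
    N k H (Z * comul (R := k) h) = counit (R := k) h • N k H Z := by
  induction Z with
  | zero => simp
  | add x y hx hy => simp only [map_add, hx, hy, add_mul, smul_add]
  | tmul a b =>
    have key : ∀ w : H ⊗[k] H, N k H (a ⊗ₜ b * w) =
      a * LinearMap.mul' k H ((HopfAlgebra.antipode k).lTensor H w) *
        HopfAlgebra.antipode k b := by
      intro w
      induction w with
      | zero => simp
      | add x y hx hy => simp only [map_add, hx, hy, mul_add, add_mul]
      | tmul p q => simp [N_tmul, HopfAlgebra.antipode_mul_antidistrib, mul_assoc]
    rw [key, HopfAlgebra.mul_antipode_lTensor_comul_apply, N_tmul, ← Algebra.commutes,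
      Algebra.smul_def, mul_assoc]

lemma Phi_mid (Z : H ⊗[k] H) (G : H ⊗[k] (H ⊗[k] H)) :
    Phi k H (((1 : H) ⊗ₜ[k] i12 k H H Z) * D2 k H H G) = N k H (E2 k H H G) ⊗ₜ N k H Z := by
  induction G with
  | zero => simp
  | add x y hx hy => simp only [map_add, hx, hy, mul_add, TensorProduct.add_tmul]
  | tmul a x =>
    induction x with
    | zero => simp
    | add x y hx hy =>
      simp only [TensorProduct.tmul_add, map_add, hx, hy, mul_add, TensorProduct.add_tmul]
    | tmul b c =>
      have key : ∀ w : H ⊗[k] H, Phi k H (((1 : H) ⊗ₜ[k] i12 k H H Z) *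
          (a ⊗ₜ (TensorProduct.assoc k H H H (w ⊗ₜ c)))) = N k H (a ⊗ₜ c) ⊗ₜ N k H (Z * w) := by
        intro w
        induction w with
        | zero => simp
        | add x y hx hy =>
          simp only [map_add, hx, hy, mul_add, TensorProduct.tmul_add, TensorProduct.add_tmul]
        | tmul p q =>
          induction Z with
          | zero => simp
          | add x y hx hy =>
            simp only [map_add, hx, hy, add_mul, TensorProduct.tmul_add]
          | tmul r s =>
            simp [Phi, N_tmul, i12_tmul, R2_tmul]
      rw [D2_tmul, D1_tmul, key, N_mul_comul, E2_tmul, TensorProduct.tmul_smul,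
        TensorProduct.tmul_smul, map_smul, TensorProduct.smul_tmul']

lemma Psi_mid (G : H ⊗[k] (H ⊗[k] H)) :
    Psi k H (D2 k H H G) = (1 : H) ⊗ₜ
      LinearMap.mul' k H ((HopfAlgebra.antipode k).rTensor H (E2 k H H G)) := by
  induction G with
  | zero => simp
  | add x y hx hy => simp only [map_add, hx, hy, TensorProduct.tmul_add]
  | tmul a x =>
    induction x with
    | zero => simp
    | add x y hx hy =>
      simp only [TensorProduct.tmul_add, map_add, hx, hy]
    | tmul b c =>
      have key : ∀ w : H ⊗[k] H, Psi k H
          (a ⊗ₜ (TensorProduct.assoc k H H H (w ⊗ₜ c))) =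
          LinearMap.mul' k H ((HopfAlgebra.antipode k).rTensor H w) ⊗ₜ
            (HopfAlgebra.antipode k a * c) := by
        intro w
        induction w with
        | zero => simp
        | add x y hx hy =>
          simp only [map_add, hx, hy, TensorProduct.tmul_add, TensorProduct.add_tmul]
        | tmul p q => simp [Psi, R2_tmul]
      rw [D2_tmul, D1_tmul, key, HopfAlgebra.mul_antipode_rTensor_comul_apply, E2_tmul]
      simp [Algebra.algebraMap_eq_smul_one, TensorProduct.smul_tmul]

lemma assoc_map_comul (x : H ⊗[k] H) : TensorProduct.assoc k H H (H ⊗[k] H)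
    (TensorProduct.map (comul (R := k)) (comul (R := k)) x) = D1 k H (H ⊗[k] H) (DR k H x) := by
  induction x with
  | zero => simp
  | add x y hx hy => simp only [map_add, hx, hy]
  | tmul a b => rfl

lemma R2_mul (x y : H ⊗[k] H) : R2 k H (x * y) = R2 k H y * R2 k H x := by
  induction x with
  | zero => simp
  | add x y hx hy => simp only [map_add, hx, hy, mul_add, add_mul]
  | tmul a b =>
    induction y with
    | zero => simp
    | add x y hx hy => simp only [map_add, hx, hy, mul_add, add_mul]
    | tmul c d => simp [R2_tmul, HopfAlgebra.antipode_mul_antidistrib]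

lemma comul_antipode (h : H) :
    comul (R := k) (HopfAlgebra.antipode k h) = R2 k H (comul (R := k) h) := by
  have key : WithConv.toConv (R2 k H ∘ₗ comul (R := k)) =
      WithConv.toConv ((comul (R := k) (A := H)) ∘ₗ HopfAlgebra.antipode k) := by
    refine left_inv_eq_right_inv (a := WithConv.toConv (comul (R := k) (A := H))) ?_
      LinearMap.comul_right_inv
    apply WithConv.ext
    ext h
    have e : TensorProduct.map (R2 k H ∘ₗ comul (R := k)) (comul (R := k)) (comul (R := k) h) =
      TensorProduct.map (R2 k H) LinearMap.id (TensorProduct.map (comul (R := k)) (comul (R := k))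
        (comul (R := k) h)) := by
      rw [← LinearMap.comp_apply (TensorProduct.map (R2 k H) LinearMap.id),
        ← TensorProduct.map_comp, LinearMap.id_comp]
    have e2 : LinearMap.mul' k (H ⊗[k] H) (TensorProduct.map (R2 k H ∘ₗ comul (R := k))
        (comul (R := k)) (comul (R := k) h)) = Psi k H (D2 k H H (DR k H (comul (R := k) h))) := by
      rw [← D1_comul, ← D1_D1, D1_comul, ← assoc_map_comul, e]
      simp [Psi]
    change LinearMap.mul' k (H ⊗[k] H) (TensorProduct.map (R2 k H ∘ₗ comul (R := k))
        (comul (R := k)) (comul (R := k) h)) = algebraMap k (H ⊗[k] H) (counit (R := k) h)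
    rw [e2, Psi_mid, E2_DR, HopfAlgebra.mul_antipode_rTensor_comul_apply]
    simp [Algebra.algebraMap_eq_smul_one, Algebra.TensorProduct.one_def]
  have := congrArg WithConv.ofConv key
  exact (LinearMap.congr_fun this h).symm

/-- the case `n = 2` -/
lemma two_case (F : H ⊗[k] H)
    (hcu : (TensorProduct.lid k H)
      ((TensorProduct.map (counit (R := k)) LinearMap.id) F) = 1)
    (hF : ((1 : H) ⊗ₜ[k] F) * DR k H F = i12 k H H F * D1 k H H F) :
    F * comul (R := k) (N k H F) * R2 k H F = N k H F ⊗ₜ N k H F := by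
  have e1 : ∀ G : H ⊗[k] H, F * comul (R := k) (N k H G) * R2 k H F =
      Phi k H (i12 k H (H ⊗[k] H) F * ((1 : H) ⊗ₜ ((1 : H) ⊗ₜ F)) *
        D1 k H (H ⊗[k] H) (DR k H G)) := by
    intro G
    have a1 : ∀ x y z w : H ⊗[k] H, Phi k H (i12 k H (H ⊗[k] H) x * ((1 : H) ⊗ₜ ((1 : H) ⊗ₜ y)) *
        TensorProduct.assoc k H H (H ⊗[k] H) (z ⊗ₜ w)) = x * (z * R2 k H w) * R2 k H y := by
      intro x y z w
      have b1 : i12 k H (H ⊗[k] H) x * ((1 : H) ⊗ₜ ((1 : H) ⊗ₜ y)) *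
        TensorProduct.assoc k H H (H ⊗[k] H) (z ⊗ₜ w) =
          TensorProduct.assoc k H H (H ⊗[k] H) ((x * z) ⊗ₜ (y * w)) := by
        have c1 : i12 k H (H ⊗[k] H) x =
          Algebra.TensorProduct.assoc k k k H H (H ⊗[k] H) (x ⊗ₜ 1) := by
          induction x with
          | zero => simp
          | add x y hx hy => simp only [map_add, hx, hy, TensorProduct.add_tmul]
          | tmul a b => rfl
        have c2 : (1 : H) ⊗ₜ[k] ((1 : H) ⊗ₜ[k] y) =
          Algebra.TensorProduct.assoc k k k H H (H ⊗[k] H) (1 ⊗ₜ y) := rfl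
        change _ * _ * Algebra.TensorProduct.assoc k k k H H (H ⊗[k] H) (z ⊗ₜ w) =
          Algebra.TensorProduct.assoc k k k H H (H ⊗[k] H) ((x * z) ⊗ₜ (y * w))
        rw [c1, c2, ← map_mul, ← map_mul]
        simp
      rw [b1]
      simp [Phi, R2_mul, mul_assoc]
    rw [← assoc_map_comul]
    induction G with
    | zero => simp
    | add x y hx hy => simp only [map_add, hx, hy, mul_add, add_mul]
    | tmul a b =>
      rw [N_tmul, Bialgebra.comul_mul, comul_antipode, TensorProduct.map_tmul, a1]
  have e2 : E2 k H H ((1 : H) ⊗ₜ F) = 1 := by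
    change (1 : H) ⊗ₜ[k] ((TensorProduct.lid k H)
      ((TensorProduct.map (counit (R := k)) LinearMap.id) F)) = 1
    rw [hcu]; rfl
  rw [e1, four F hF, Phi_mid, map_mul, E2_DR, e2, one_mul]

end two

section many
variable {k H : Type} [Field k] [Ring H] [HopfAlgebra k H]

open Coalgebra Bialgebra

/-- the identification `H ⊗ H^{⊗(n+1)} = H^{⊗(n+2)}` as algebras -/
noncomputable def C (k H : Type) [Field k] [Ring H] [HopfAlgebra k H] (n : ℕ) :
    H ⊗[k] Tpow k H n ≃ₐ[k] Tpow k H (n + 1) :=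
  show H ⊗[k] Tpow k H n ≃ₐ[k] H ⊗[k] Tpow k H n from AlgEquiv.refl

/-- iterated comultiplication as an algebra map -/
noncomputable def Dn (k H : Type) [Field k] [Ring H] [HopfAlgebra k H] :
    ∀ n : ℕ, H →ₐ[k] Tpow k H n
  | 0 => show H →ₐ[k] H from AlgHom.id k H
  | n + 1 => (C k H n).toAlgHom.comp
      ((Algebra.TensorProduct.map (AlgHom.id k H) (Dn k H n)).comp (comulAlgHom k H))

/-- appending a last leg, as an algebra map -/
noncomputable def Sn (k H : Type) [Field k] [Ring H] [HopfAlgebra k H] :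
    ∀ n : ℕ, Tpow k H n ⊗[k] H →ₐ[k] Tpow k H (n + 1)
  | 0 => show H ⊗[k] H →ₐ[k] H ⊗[k] H from AlgHom.id k _
  | n + 1 => (C k H (n + 1)).toAlgHom.comp
      ((Algebra.TensorProduct.map (AlgHom.id k H) (Sn k H n)).comp
        ((Algebra.TensorProduct.assoc k k k H (Tpow k H n) H).toAlgHom.comp
          (Algebra.TensorProduct.map (C k H n).symm.toAlgHom (AlgHom.id k H))))

lemma C_ind {n : ℕ} {P : Tpow k H (n + 1) → Prop} (h0 : P 0)
    (ha : ∀ x y, P x → P y → P (x + y)) (ht : ∀ a x, P (C k H n (a ⊗ₜ x)))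
    (x : Tpow k H (n + 1)) : P x := by
  obtain ⟨y, rfl⟩ := (C k H n).surjective x
  induction y with
  | zero => rw [map_zero]; exact h0
  | add x y hx hy => rw [map_add]; exact ha _ _ hx hy
  | tmul a x => exact ht a x

lemma Dn_succ (n : ℕ) (h : H) : Dn k H (n + 1) h =
    C k H n (Algebra.TensorProduct.map (AlgHom.id k H) (Dn k H n) (comul (R := k) h)) := rfl

lemma comulIter_eq (n : ℕ) (h : H) : comulIter k H n h = Dn k H n h := by
  have : ∀ n, comulIter k H n = (Dn k H n).toLinearMap := by
    intro n
    induction n with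
    | zero => rfl
    | succ n ih =>
      change (TensorProduct.map LinearMap.id (comulIter k H n)) ∘ₗ Coalgebra.comul = _
      rw [ih]; rfl
  rw [this]; rfl

lemma Sn_zero (x : H ⊗[k] H) : Sn k H 0 x = C k H 0 x := rfl

lemma Sn_succ (n : ℕ) (a h : H) (x : Tpow k H n) :
    Sn k H (n + 1) (C k H n (a ⊗ₜ x) ⊗ₜ h) = C k H (n + 1) (a ⊗ₜ Sn k H n (x ⊗ₜ h)) := rfl

lemma snocEquiv_eq (n : ℕ) (x : Tpow k H n ⊗[k] H) : snocEquiv k H n x = Sn k H n x := by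
  have : ∀ n, (snocEquiv k H n).toLinearMap = (Sn k H n).toLinearMap := by
    intro n
    induction n with
    | zero => rfl
    | succ n ih =>
      apply LinearMap.ext
      intro x
      induction x with
      | zero => simp
      | add x y hx hy => simp only [map_add, hx, hy]
      | tmul x h =>
        revert x; apply C_ind
        · simp
        · intro x y hx hy
          rw [TensorProduct.add_tmul, map_add, map_add, hx, hy]
        · intro a x
          change C k H (n + 1) (a ⊗ₜ (snocEquiv k H n).toLinearMap (x ⊗ₜ h)) = _
          rw [ih]; rfl
  exact LinearMap.congr_fun (this n) x

/-- `S^{⊗n}` followed by reversal -/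
noncomputable def Rn (k H : Type) [Field k] [Ring H] [HopfAlgebra k H] (n : ℕ) :
    Tpow k H n →ₗ[k] Tpow k H n :=
  revT k H n ∘ₗ tmapPow k H (HopfAlgebra.antipode k) n

lemma Rn_zero (x : H) : Rn k H 0 x = HopfAlgebra.antipode k x := rfl

lemma Rn_succ (n : ℕ) (a : H) (x : Tpow k H n) :
    Rn k H (n + 1) (C k H n (a ⊗ₜ x)) = Sn k H n (Rn k H n x ⊗ₜ HopfAlgebra.antipode k a) := by
  rw [← snocEquiv_eq]; rfl

lemma Rn_snoc (n : ℕ) (h : H) (x : Tpow k H n) :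
    Rn k H (n + 1) (Sn k H n (x ⊗ₜ h)) = C k H n (HopfAlgebra.antipode k h ⊗ₜ Rn k H n x) := by
  induction n with
  | zero => rfl
  | succ n ih =>
    revert x; apply C_ind
    · simp
    · intro x y hx hy
      rw [TensorProduct.add_tmul, map_add, map_add, map_add, TensorProduct.tmul_add, map_add,
        hx, hy]
    · intro a x
      rw [Sn_succ, Rn_succ, ih, Sn_succ, Rn_succ]

lemma Rn_mul (n : ℕ) (x y : Tpow k H n) : Rn k H n (x * y) = Rn k H n y * Rn k H n x := by
  induction n with
  | zero => exact HopfAlgebra.antipode_mul_antidistrib (R := k) (A := H) x y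
  | succ n ih =>
    revert x; apply C_ind
    · simp
    · intro x x' hx hx'
      rw [add_mul, map_add, map_add, mul_add, hx, hx']
    · intro a x
      revert y; apply C_ind
      · simp
      · intro y y' hx hx'
        rw [mul_add, map_add, map_add, add_mul, hx, hx']
      · intro b y
        rw [← map_mul, Algebra.TensorProduct.tmul_mul_tmul, Rn_succ, Rn_succ, Rn_succ, ← map_mul,
          Algebra.TensorProduct.tmul_mul_tmul, ih, HopfAlgebra.antipode_mul_antidistrib]

/-- `id ⊗ Δⁿ ⊗ id` -/
noncomputable def W (k H : Type) [Field k] [Ring H] [HopfAlgebra k H] (n : ℕ) :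
    H ⊗[k] (H ⊗[k] H) →ₐ[k] Tpow k H (n + 2) :=
  (C k H (n + 1)).toAlgHom.comp (Algebra.TensorProduct.map (AlgHom.id k H)
    ((Sn k H n).comp (Algebra.TensorProduct.map (Dn k H n) (AlgHom.id k H))))

/-- `id ⊗ Δⁿ` -/
noncomputable def V (k H : Type) [Field k] [Ring H] [HopfAlgebra k H] (n : ℕ) :
    H ⊗[k] H →ₐ[k] Tpow k H (n + 1) :=
  (C k H n).toAlgHom.comp (Algebra.TensorProduct.map (AlgHom.id k H) (Dn k H n))

/-- `Δⁿ ⊗ id` -/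
noncomputable def V' (k H : Type) [Field k] [Ring H] [HopfAlgebra k H] (n : ℕ) :
    H ⊗[k] H →ₐ[k] Tpow k H (n + 1) :=
  (Sn k H n).comp (Algebra.TensorProduct.map (Dn k H n) (AlgHom.id k H))

lemma V_tmul (n : ℕ) (a b : H) : V k H n (a ⊗ₜ b) = C k H n (a ⊗ₜ Dn k H n b) := rfl
lemma V'_tmul (n : ℕ) (a b : H) : V' k H n (a ⊗ₜ b) = Sn k H n (Dn k H n a ⊗ₜ b) := rfl
lemma W_tmul (n : ℕ) (a : H) (x : H ⊗[k] H) :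
    W k H n (a ⊗ₜ x) = C k H (n + 1) (a ⊗ₜ V' k H n x) := rfl

lemma W_D1 (n : ℕ) (z : H ⊗[k] H) : W k H n (D1 k H H z) = V' k H (n + 1) z := by
  induction z with
  | zero => simp
  | add x y hx hy => simp only [map_add, hx, hy]
  | tmul a b =>
    rw [V'_tmul, Dn_succ, D1_tmul]
    generalize comul (R := k) a = w
    induction w with
    | zero => simp
    | add x y hx hy => simp only [map_add, hx, hy, TensorProduct.add_tmul]
    | tmul p q => rfl

lemma W_i12 (n : ℕ) (z : H ⊗[k] H) :
    W k H n (i12 k H H z) = Sn k H (n + 1) (V k H n z ⊗ₜ 1) := by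
  induction z with
  | zero => simp
  | add x y hx hy => simp only [map_add, hx, hy, TensorProduct.add_tmul]
  | tmul a b => rfl

lemma Dn_V (n : ℕ) (h : H) : Dn k H (n + 1) h = V k H n (comul (R := k) h) := rfl

lemma V_of_snoc (n : ℕ) (hn : ∀ h : H, Dn k H (n + 1) h = V' k H n (comul (R := k) h))
    (z : H ⊗[k] H) : V k H (n + 1) z = W k H n (DR k H z) := by
  induction z with
  | zero => simp
  | add x y hx hy => simp only [map_add, hx, hy]
  | tmul a b => rw [V_tmul, DR_tmul, W_tmul, hn]

lemma Dn_snoc (n : ℕ) (h : H) : Dn k H (n + 1) h = V' k H n (comul (R := k) h) := by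
  induction n generalizing h with
  | zero => rfl
  | succ n ih => rw [Dn_V, V_of_snoc n ih, ← D1_comul, W_D1]

lemma Rn_V (n : ℕ) (hn : ∀ h : H, Rn k H n (Dn k H n h) = Dn k H n (HopfAlgebra.antipode k h))
    (z : H ⊗[k] H) : Rn k H (n + 1) (V k H n z) = V' k H n (R2 k H z) := by
  induction z with
  | zero => simp
  | add x y hx hy => simp only [map_add, hx, hy]
  | tmul a b => rw [V_tmul, Rn_succ, hn, R2_tmul, V'_tmul]

lemma Rn_Dn (n : ℕ) (h : H) : Rn k H n (Dn k H n h) = Dn k H n (HopfAlgebra.antipode k h) := by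
  induction n generalizing h with
  | zero => rfl
  | succ n ih => rw [Dn_V, Rn_V n ih, Dn_snoc, comul_antipode]

lemma Rn_V' (n : ℕ) (z : H ⊗[k] H) : Rn k H (n + 1) (V' k H n z) = V k H n (R2 k H z) := by
  induction z with
  | zero => simp
  | add x y hx hy => simp only [map_add, hx, hy]
  | tmul a b => rw [V'_tmul, Rn_snoc, Rn_Dn, R2_tmul, V_tmul]

lemma Fseq_succ (F : H ⊗[k] H) (n : ℕ) :
    Fseq k H F (n + 1) = C k H n (1 ⊗ₜ Fseq k H F n) * V k H n F := by
  have : comulIter k H n = (Dn k H n).toLinearMap := LinearMap.ext (comulIter_eq n)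
  change ((1 : H) ⊗ₜ[k] Fseq k H F n) * (TensorProduct.map LinearMap.id (comulIter k H n) F) = _
  rw [this]; rfl

lemma Fseq_snoc (F : H ⊗[k] H)
    (hF : ((1 : H) ⊗ₜ[k] F) * DR k H F = i12 k H H F * D1 k H H F) (n : ℕ) :
    Fseq k H F (n + 1) = Sn k H n (Fseq k H F n ⊗ₜ 1) * V' k H n F := by
  induction n with
  | zero => rw [Fseq_succ]; rfl
  | succ n ih =>
    have e : C k H (n + 1) ((1 : H) ⊗ₜ Fseq k H F (n + 1)) =
        C k H (n + 1) ((1 : H) ⊗ₜ Sn k H n (Fseq k H F n ⊗ₜ 1)) * W k H n (1 ⊗ₜ F) := by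
      rw [ih, W_tmul, ← map_mul, Algebra.TensorProduct.tmul_mul_tmul, one_mul]
    have e2 : Sn k H (n + 1) (Fseq k H F (n + 1) ⊗ₜ (1 : H)) =
        C k H (n + 1) ((1 : H) ⊗ₜ Sn k H n (Fseq k H F n ⊗ₜ 1)) * W k H n (i12 k H H F) := by
      rw [Fseq_succ, W_i12, ← Sn_succ, ← map_mul, Algebra.TensorProduct.tmul_mul_tmul, one_mul]
    rw [Fseq_succ, e, V_of_snoc n (Dn_snoc n), mul_assoc, ← map_mul, hF, map_mul, ← mul_assoc,
      ← e2, W_D1]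

lemma Fseq_isUnit (F : H ⊗[k] H) (hF : IsUnit F) (n : ℕ) : IsUnit (Fseq k H F n) := by
  induction n with
  | zero => exact isUnit_one
  | succ n ih =>
    rw [Fseq_succ]
    exact ((ih.map (Algebra.TensorProduct.includeRight :
      Tpow k H n →ₐ[k] H ⊗[k] Tpow k H n)).map (C k H n)).mul (hF.map (V k H n))

lemma main (F : H ⊗[k] H)
    (hF : ((1 : H) ⊗ₜ[k] F) * DR k H F = i12 k H H F * D1 k H H F) (u : H)
    (h2 : F * comul (R := k) u * R2 k H F = u ⊗ₜ u) (n : ℕ) :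
    Fseq k H F n * Dn k H n u * Rn k H n (Fseq k H F n) = nest k H n (fun _ => u) := by
  induction n with
  | zero =>
    change (1 : H) * u * HopfAlgebra.antipode k (1 : H) = u
    simp
  | succ n ih =>
    have e : Rn k H (n + 1) (Fseq k H F (n + 1)) =
        V k H n (R2 k H F) * C k H n (1 ⊗ₜ Rn k H n (Fseq k H F n)) := by
      rw [Fseq_snoc F hF, Rn_mul, Rn_V', Rn_snoc, HopfAlgebra.antipode_one]
    calc Fseq k H F (n + 1) * Dn k H (n + 1) u * Rn k H (n + 1) (Fseq k H F (n + 1))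
        = C k H n (1 ⊗ₜ Fseq k H F n) * V k H n (F * comul (R := k) u * R2 k H F) *
          C k H n (1 ⊗ₜ Rn k H n (Fseq k H F n)) := by
          rw [e, Fseq_succ, Dn_V, map_mul, map_mul]; simp only [mul_assoc]
      _ = C k H n (u ⊗ₜ (Fseq k H F n * Dn k H n u * Rn k H n (Fseq k H F n))) := by
          rw [h2, V_tmul, ← map_mul, ← map_mul, Algebra.TensorProduct.tmul_mul_tmul,
            Algebra.TensorProduct.tmul_mul_tmul, one_mul, mul_one]
      _ = nest k H (n + 1) (fun _ => u) := by rw [ih]; rfl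

lemma Rn_one (n : ℕ) : Rn k H n 1 = 1 := by
  have := Rn_Dn (k := k) n (1 : H)
  rwa [HopfAlgebra.antipode_one, map_one] at this

end many

end TwistAux

theorem statement9
    (k H : Type) [Field k] [Ring H] [HopfAlgebra k H] [FiniteDimensional k H]
    (S : H →ₗ[k] H) (hS : S = HopfAlgebra.antipode (R := k))
    (F F' : H ⊗[k] H)
    (hinv₁ : F * F' = 1) (hinv₂ : F' * F = 1)
    (hcu₁ : (TensorProduct.lid k H)
      ((TensorProduct.map (Coalgebra.counit (R := k)) LinearMap.id) F) = 1)
    (hcu₂ : (TensorProduct.rid k H)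
      ((TensorProduct.map LinearMap.id (Coalgebra.counit (R := k))) F) = 1)
    (hcoc : ((1 : H) ⊗ₜ[k] F) *
        (TensorProduct.map LinearMap.id (Coalgebra.comul (R := k)) F) =
      (TensorProduct.assoc k H H H)
        ((F ⊗ₜ[k] (1 : H)) *
          (TensorProduct.map (Coalgebra.comul (R := k)) LinearMap.id F)))
    (u : H) (hu : u = LinearMap.mul' k H ((TensorProduct.map LinearMap.id S) F))
    (n : ℕ) (hn : 1 ≤ n) :
    comulIter k H (n - 1) u =
      Ring.inverse (Fseq k H F (n - 1)) *
        nest k H (n - 1) (fun _ => u) *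
        revT k H (n - 1) (tmapPow k H S (n - 1) (Ring.inverse (Fseq k H F (n - 1)))) := by
  obtain ⟨m, rfl⟩ : ∃ m, n = m + 1 := ⟨n - 1, by omega⟩
  rw [Nat.add_sub_cancel]
  subst hS
  have hF : ((1 : H) ⊗ₜ[k] F) * TwistAux.DR k H F =
      TwistAux.i12 k H H F * TwistAux.D1 k H H F := by
    refine hcoc.trans ?_
    change Algebra.TensorProduct.assoc k k k H H H _ = _
    rw [map_mul]
    congr 1
    clear * -
    induction F with
    | zero => simp
    | add x y hx hy => simp only [map_add, hx, hy, TensorProduct.add_tmul]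
    | tmul a b => rfl
  have hu' : u = TwistAux.N k H F := hu
  have h2 := TwistAux.two_case F hcu₁ hF
  rw [← hu'] at h2
  have hm := TwistAux.main F hF u h2 m
  have hun : IsUnit (Fseq k H F m) :=
    TwistAux.Fseq_isUnit F ⟨⟨F, F', hinv₁, hinv₂⟩, rfl⟩ m
  have hR : TwistAux.Rn k H m (Fseq k H F m) *
      TwistAux.Rn k H m (Ring.inverse (Fseq k H F m)) = 1 := by
    rw [← TwistAux.Rn_mul, Ring.inverse_mul_cancel _ hun, TwistAux.Rn_one]
  rw [TwistAux.comulIter_eq, ← hm]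
  change _ = _ * _ * TwistAux.Rn k H m (Ring.inverse (Fseq k H F m))
  rw [mul_assoc, mul_assoc, hR, mul_one, ← mul_assoc, Ring.inverse_mul_cancel _ hun, one_mul]
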